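/- Let S be a real random variable with convex support Ω_S ⊆ ℝ, E[S] = 0, Var(S) = 1, Lebesgue density f_S ∈ C¹, first and second-order score functions ρ_S, I_S ∈ L²(S), and ‖ρ_S(S)·S‖₂ < ∞, and let Z_t = e^{−t}S + √(1−e^{−2t})Z with Z standard Gaussian independent of S and density f_{Z_t}. Then for every T > 0, ∫₀^T ∫_{Ω_S} √(f_S(x)) · |∂_t √(f_{Z_t}(x))| dx dt < ∞. -/

import Mathlib

open MeasureTheory ProbabilityTheory Real Filter

noncomputable section

/-- The standard Gaussian density on ℝ. -/
def stdGaussianDensity (x : ℝ) : ℝ := (Real.sqrt (2 * Real.pi))⁻¹ * Real.exp (-(x ^ 2) / 2)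

/-- Hellinger distance between a random variable with Lebesgue density `f`
and a standard Gaussian. -/
def hellingerToGauss (f : ℝ → ℝ) : ℝ :=
  Real.sqrt ((1 / 2) * ∫ x : ℝ, (Real.sqrt (f x) - Real.sqrt (stdGaussianDensity x)) ^ 2)

/-- `S` has Lebesgue density `f` under `μ`. -/
def HasLebDensity {Ω : Type*} [MeasurableSpace Ω] (μ : Measure Ω) (S : Ω → ℝ) (f : ℝ → ℝ) :
    Prop :=
  Measure.map S μ = volume.withDensity (fun x => ENNReal.ofReal (f x))

/-- `ρ` is a (first-order) score function for `S`:
`E[ρ(S)Ψ(S)] = -E[Ψ'(S)]` for all `Ψ ∈ C_c^∞(ℝ)`, with `ρ ∈ L¹(S)`. -/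
def IsScoreFun {Ω : Type*} [MeasurableSpace Ω] (μ : Measure Ω) (S : Ω → ℝ) (ρ : ℝ → ℝ) :
    Prop :=
  Integrable (fun ω => ρ (S ω)) μ ∧
    ∀ Ψ : ℝ → ℝ, ContDiff ℝ (⊤ : ℕ∞) Ψ → HasCompactSupport Ψ →
      ∫ ω, ρ (S ω) * Ψ (S ω) ∂μ = -∫ ω, deriv Ψ (S ω) ∂μ

/-- `I` is a second-order score function for `S`:
`E[I(S)Ψ(S)] = E[Ψ''(S)]` for all `Ψ ∈ C_c^∞(ℝ)`, with `I ∈ L¹(S)`. -/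
def IsScoreFun2 {Ω : Type*} [MeasurableSpace Ω] (μ : Measure Ω) (S : Ω → ℝ) (I : ℝ → ℝ) :
    Prop :=
  Integrable (fun ω => I (S ω)) μ ∧
    ∀ Ψ : ℝ → ℝ, ContDiff ℝ (⊤ : ℕ∞) Ψ → HasCompactSupport Ψ →
      ∫ ω, I (S ω) * Ψ (S ω) ∂μ = ∫ ω, deriv (deriv Ψ) (S ω) ∂μ

/-- The L² norm `‖T‖₂ = (E|T|²)^{1/2}` of a random variable. -/
def l2norm {Ω : Type*} [MeasurableSpace Ω] (μ : Measure Ω) (T : Ω → ℝ) : ℝ :=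
  Real.sqrt (∫ ω, (T ω) ^ 2 ∂μ)

/-- The k-th probabilist's Hermite polynomial, evaluated at `x : ℝ`. -/
def hermiteR (k : ℕ) (x : ℝ) : ℝ := Polynomial.aeval x (Polynomial.hermite k)


/-- The density of the Ornstein–Uhlenbeck interpolant `Z_t = e^{-t}S + √(1-e^{-2t})Z`
for a variable `S` with density `fS` (equal to `fS` at `t = 0`). -/
def ouDensity (fS : ℝ → ℝ) (t x : ℝ) : ℝ :=
  if t = 0 then fS x
  else ∫ y : ℝ,
    stdGaussianDensity (y / Real.sqrt (1 - Real.exp (-2 * t))) / Real.sqrt (1 - Real.exp (-2 * t))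
      * (fS ((x - y) / Real.exp (-t)) / Real.exp (-t))

/-- A smooth compactly supported cutoff, equal to `1` at the origin. -/
theorem exists_smooth_cutoff :
    ∃ (χ : ℝ → ℝ) (C : ℝ), ContDiff ℝ (⊤ : ℕ∞) χ ∧ HasCompactSupport χ ∧ χ 0 = 1 ∧
      (∀ x, |χ x| ≤ C) ∧ (∀ x, |deriv χ x| ≤ C) ∧ ∀ x, |deriv (deriv χ) x| ≤ C := by
  let b : ContDiffBump (0 : ℝ) := ⟨1, 2, one_pos, one_lt_two⟩
  have hb : ContDiff ℝ (⊤ : ℕ∞) (b : ℝ → ℝ) := b.contDiff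
  have hb1 : ContDiff ℝ (⊤ : ℕ∞) (deriv b) := (contDiff_infty_iff_deriv.1 hb).2
  have hb2 : ContDiff ℝ (⊤ : ℕ∞) (deriv (deriv b)) := (contDiff_infty_iff_deriv.1 hb1).2
  obtain ⟨C₀, h₀⟩ := hb.continuous.bounded_above_of_compact_support b.hasCompactSupport
  obtain ⟨C₁, h₁⟩ := hb1.continuous.bounded_above_of_compact_support b.hasCompactSupport.deriv
  obtain ⟨C₂, h₂⟩ :=
    hb2.continuous.bounded_above_of_compact_support b.hasCompactSupport.deriv.deriv
  refine ⟨b, max C₀ (max C₁ C₂), hb, b.hasCompactSupport, ?_, fun x => ?_, fun x => ?_,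
    fun x => ?_⟩
  · exact b.one_of_mem_closedBall (by simp [b])
  · exact (h₀ x).trans (le_max_left _ _)
  · exact (h₁ x).trans ((le_max_left _ _).trans (le_max_right _ _))
  · exact (h₂ x).trans ((le_max_right _ _).trans (le_max_right _ _))

theorem tendsto_integral_bdd_mul {Ω : Type*} [MeasurableSpace Ω] {μ : Measure Ω} {F : Ω → ℝ}
    (hF : Integrable F μ) {g : ℕ → Ω → ℝ} (hg : ∀ n, AEStronglyMeasurable (g n) μ) {C c : ℝ}
    (hC : ∀ n ω, |g n ω| ≤ C) (hlim : ∀ ω, Tendsto (fun n => g n ω) atTop (nhds c)) :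
    Tendsto (fun n => ∫ ω, g n ω * F ω ∂μ) atTop (nhds (c * ∫ ω, F ω ∂μ)) := by
  rw [← integral_const_mul]
  refine tendsto_integral_of_dominated_convergence (fun ω => C * |F ω|)
    (fun n => (hg n).mul hF.aestronglyMeasurable) (hF.abs.const_mul C) (fun n => ?_) ?_
  · refine Eventually.of_forall fun ω => ?_
    rw [Real.norm_eq_abs, abs_mul]
    exact mul_le_mul_of_nonneg_right (hC n ω) (abs_nonneg _)
  · exact Eventually.of_forall fun ω => (hlim ω).mul_const _

theorem tendsto_integral_dilation_mul {Ω : Type*} [MeasurableSpace Ω] {μ : Measure Ω}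
    {S : Ω → ℝ} (hS : Measurable S) {F : Ω → ℝ} (hF : Integrable F μ) {χ : ℝ → ℝ}
    (hχ : Continuous χ) {C : ℝ} (hC : ∀ x, |χ x| ≤ C) :
    Tendsto (fun n : ℕ => ∫ ω, χ (1 / ((n : ℝ) + 1) * S ω) * F ω ∂μ) atTop
      (nhds (χ 0 * ∫ ω, F ω ∂μ)) := by
  refine tendsto_integral_bdd_mul hF
    (fun n => (hχ.measurable.comp (hS.const_mul _)).aestronglyMeasurable) (fun n ω => hC _)
    fun ω => ?_
  have h := (tendsto_one_div_add_atTop_nhds_zero_nat (𝕜 := ℝ)).mul_const (S ω)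
  rw [zero_mul] at h
  exact (hχ.tendsto 0).comp h

theorem deriv_dilation_mul {χ Ψ : ℝ → ℝ} (hχ : Differentiable ℝ χ) (hΨ : Differentiable ℝ Ψ)
    (c : ℝ) :
    deriv (fun s => χ (c * s) * Ψ s) =
      fun s => c * (deriv χ (c * s) * Ψ s) + χ (c * s) * deriv Ψ s := by
  funext s
  have h1 : HasDerivAt (fun s => χ (c * s)) (deriv χ (c * s) * (c * 1)) s :=
    (hχ (c * s)).hasDerivAt.comp s ((hasDerivAt_id s).const_mul c)
  exact (h1.mul (hΨ s).hasDerivAt).deriv.trans (by ring)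

theorem contDiff_dilation_mul {χ Ψ : ℝ → ℝ} (hχ : ContDiff ℝ (⊤ : ℕ∞) χ)
    (hΨ : ContDiff ℝ (⊤ : ℕ∞) Ψ) (c : ℝ) :
    ContDiff ℝ (⊤ : ℕ∞) (fun s => χ (c * s) * Ψ s) :=
  (hχ.comp (contDiff_const.mul contDiff_id)).mul hΨ

theorem hasCompactSupport_dilation_mul {χ Ψ : ℝ → ℝ} (hχ : HasCompactSupport χ) {c : ℝ}
    (hc : c ≠ 0) : HasCompactSupport (fun s => χ (c * s) * Ψ s) := by
  have h : HasCompactSupport (fun s => χ (c * s)) :=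
    hχ.comp_homeomorph (Homeomorph.mulLeft₀ c hc)
  exact h.mul_right

theorem integrable_dilation_mul {Ω : Type*} [MeasurableSpace Ω] {μ : Measure Ω}
    {S : Ω → ℝ} (hS : Measurable S) {F : Ω → ℝ} (hF : Integrable F μ) {χ : ℝ → ℝ}
    (hχ : Continuous χ) {C : ℝ} (hC : ∀ x, |χ x| ≤ C) (c : ℝ) :
    Integrable (fun ω => χ (c * S ω) * F ω) μ :=
  hF.bdd_mul (hχ.measurable.comp (hS.const_mul c)).aestronglyMeasurable
    (Eventually.of_forall fun _ => hC _)

/-- The defining identity of a score function extends to smooth test functions which need not be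
compactly supported, provided all the terms are integrable. -/
theorem IsScoreFun.integral_mul_eq {Ω : Type*} [MeasurableSpace Ω] {μ : Measure Ω}
    {S : Ω → ℝ} (hS : Measurable S) {ρ Ψ : ℝ → ℝ} (hρ : IsScoreFun μ S ρ)
    (hΨ : ContDiff ℝ (⊤ : ℕ∞) Ψ) (h : Integrable (fun ω => ρ (S ω) * Ψ (S ω)) μ)
    (h0 : Integrable (fun ω => Ψ (S ω)) μ) (h1 : Integrable (fun ω => deriv Ψ (S ω)) μ) :
    ∫ ω, ρ (S ω) * Ψ (S ω) ∂μ = -∫ ω, deriv Ψ (S ω) ∂μ := by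
  obtain ⟨χ, C, hχ, hχs, hχ0, hC0, hC1, -⟩ := exists_smooth_cutoff
  have hχ' : ContDiff ℝ (⊤ : ℕ∞) (deriv χ) := (contDiff_infty_iff_deriv.1 hχ).2
  have hdχ : Differentiable ℝ χ := (contDiff_infty_iff_deriv.1 hχ).1
  have hdΨ : Differentiable ℝ Ψ := (contDiff_infty_iff_deriv.1 hΨ).1
  have key : ∀ n : ℕ, ∫ ω, χ (1 / ((n : ℝ) + 1) * S ω) * (ρ (S ω) * Ψ (S ω)) ∂μ =
      -(1 / ((n : ℝ) + 1) * ∫ ω, deriv χ (1 / ((n : ℝ) + 1) * S ω) * Ψ (S ω) ∂μ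
        + ∫ ω, χ (1 / ((n : ℝ) + 1) * S ω) * deriv Ψ (S ω) ∂μ) := by
    intro n
    have hc : (1 / ((n : ℝ) + 1)) ≠ 0 := by positivity
    have e := hρ.2 _ (contDiff_dilation_mul hχ hΨ (1 / ((n : ℝ) + 1)))
      (hasCompactSupport_dilation_mul hχs hc)
    rw [deriv_dilation_mul hdχ hdΨ, integral_add
      ((integrable_dilation_mul hS h0 hχ'.continuous hC1 _).const_mul _)
      (integrable_dilation_mul hS h1 hχ.continuous hC0 _), integral_const_mul] at e
    rw [← e]
    exact integral_congr_ae (Eventually.of_forall fun ω => by ring)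
  have l1 := tendsto_integral_dilation_mul hS h hχ.continuous hC0
  have l2 := (((tendsto_one_div_add_atTop_nhds_zero_nat (𝕜 := ℝ)).mul
    (tendsto_integral_dilation_mul hS h0 hχ'.continuous hC1)).add
    (tendsto_integral_dilation_mul hS h1 hχ.continuous hC0)).neg
  simp_rw [key] at l1
  have e := tendsto_nhds_unique l1 l2
  simpa [hχ0] using e

/-- The defining identity of a second-order score function extends to smooth test functions which
need not be compactly supported, provided all the terms are integrable. -/
theorem IsScoreFun2.integral_mul_eq {Ω : Type*} [MeasurableSpace Ω] {μ : Measure Ω}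
    {S : Ω → ℝ} (hS : Measurable S) {I Ψ : ℝ → ℝ} (hI : IsScoreFun2 μ S I)
    (hΨ : ContDiff ℝ (⊤ : ℕ∞) Ψ) (h : Integrable (fun ω => I (S ω) * Ψ (S ω)) μ)
    (h0 : Integrable (fun ω => Ψ (S ω)) μ) (h1 : Integrable (fun ω => deriv Ψ (S ω)) μ)
    (h2 : Integrable (fun ω => deriv (deriv Ψ) (S ω)) μ) :
    ∫ ω, I (S ω) * Ψ (S ω) ∂μ = ∫ ω, deriv (deriv Ψ) (S ω) ∂μ := by
  obtain ⟨χ, C, hχ, hχs, hχ0, hC0, hC1, hC2⟩ := exists_smooth_cutoff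
  obtain ⟨hdχ, hχ'⟩ := contDiff_infty_iff_deriv.1 hχ
  obtain ⟨hdχ', hχ''⟩ := contDiff_infty_iff_deriv.1 hχ'
  obtain ⟨hdΨ, hΨ'⟩ := contDiff_infty_iff_deriv.1 hΨ
  obtain ⟨hdΨ', -⟩ := contDiff_infty_iff_deriv.1 hΨ'
  have hd2 : ∀ c : ℝ, deriv (deriv (fun s => χ (c * s) * Ψ s)) = fun s =>
      (c ^ 2 * (deriv (deriv χ) (c * s) * Ψ s) + 2 * c * (deriv χ (c * s) * deriv Ψ s))
        + χ (c * s) * deriv (deriv Ψ) s := by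
    intro c
    funext s
    have hA := deriv_dilation_mul hdχ' hdΨ c
    have hB := deriv_dilation_mul hdχ hdΨ' c
    have dA : Differentiable ℝ (fun s => c * (deriv χ (c * s) * Ψ s)) := by fun_prop
    have dB : Differentiable ℝ (fun s => χ (c * s) * deriv Ψ s) := by fun_prop
    rw [deriv_dilation_mul hdχ hdΨ, deriv_fun_add (dA s) (dB s), hB, deriv_const_mul_field, hA]
    ring
  have key : ∀ n : ℕ, ∫ ω, χ (1 / ((n : ℝ) + 1) * S ω) * (I (S ω) * Ψ (S ω)) ∂μ =
      ((1 / ((n : ℝ) + 1)) ^ 2 * ∫ ω, deriv (deriv χ) (1 / ((n : ℝ) + 1) * S ω) * Ψ (S ω) ∂μ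
        + 2 * (1 / ((n : ℝ) + 1)) *
          ∫ ω, deriv χ (1 / ((n : ℝ) + 1) * S ω) * deriv Ψ (S ω) ∂μ)
        + ∫ ω, χ (1 / ((n : ℝ) + 1) * S ω) * deriv (deriv Ψ) (S ω) ∂μ := by
    intro n
    have hc : (1 / ((n : ℝ) + 1)) ≠ 0 := by positivity
    have e := hI.2 _ (contDiff_dilation_mul hχ hΨ (1 / ((n : ℝ) + 1)))
      (hasCompactSupport_dilation_mul hχs hc)
    have i0 := (integrable_dilation_mul hS h0 hχ''.continuous hC2
      (1 / ((n : ℝ) + 1))).const_mul ((1 / ((n : ℝ) + 1)) ^ 2)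
    have i1 := (integrable_dilation_mul hS h1 hχ'.continuous hC1
      (1 / ((n : ℝ) + 1))).const_mul (2 * (1 / ((n : ℝ) + 1)))
    rw [hd2] at e
    have i2 := integrable_dilation_mul hS h2 hχ.continuous hC0 (1 / ((n : ℝ) + 1))
    have e' := integral_add (i0.add i1) i2
    simp only [Pi.add_apply] at e'
    rw [← integral_const_mul, ← integral_const_mul, ← integral_add i0 i1, ← e']
    refine Eq.trans ?_ e
    exact integral_congr_ae (Eventually.of_forall fun ω => by ring)
  have l1 := tendsto_integral_dilation_mul hS h hχ.continuous hC0
  have l0 := tendsto_one_div_add_atTop_nhds_zero_nat (𝕜 := ℝ)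
  have l2 := (((l0.pow 2).mul (tendsto_integral_dilation_mul hS h0 hχ''.continuous hC2)).add
    ((l0.const_mul 2).mul (tendsto_integral_dilation_mul hS h1 hχ'.continuous hC1))).add
    (tendsto_integral_dilation_mul hS h2 hχ.continuous hC0)
  simp_rw [key] at l1
  have e := tendsto_nhds_unique l1 l2
  simpa [hχ0] using e

/-- The transition density of the Ornstein–Uhlenbeck semigroup, from `s` to `x` in time `t`. -/
def ouKernel (t x s : ℝ) : ℝ :=
  (Real.sqrt (2 * π * (1 - Real.exp (-2 * t))))⁻¹ *
    Real.exp (-(x - Real.exp (-t) * s) ^ 2 / (2 * (1 - Real.exp (-2 * t))))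

theorem one_sub_exp_pos {t : ℝ} (ht : 0 < t) : 0 < 1 - Real.exp (-2 * t) := by
  have : Real.exp (-2 * t) < 1 := Real.exp_lt_one_iff.2 (by linarith)
  linarith

theorem ouKernel_pos {t : ℝ} (ht : 0 < t) (x s : ℝ) : 0 < ouKernel t x s := by
  have := one_sub_exp_pos ht
  unfold ouKernel
  positivity

theorem ouKernel_le {t : ℝ} (ht : 0 < t) (x s : ℝ) :
    ouKernel t x s ≤ (Real.sqrt (2 * π * (1 - Real.exp (-2 * t))))⁻¹ := by
  have := one_sub_exp_pos ht
  refine mul_le_of_le_one_right (by positivity) (Real.exp_le_one_iff.2 ?_)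
  rw [neg_div]
  exact neg_nonpos.2 (by positivity)

theorem contDiff_ouKernel (t x : ℝ) : ContDiff ℝ (⊤ : ℕ∞) (ouKernel t x) := by
  unfold ouKernel
  fun_prop

theorem hasDerivAt_ouKernel_source (t x s : ℝ) :
    HasDerivAt (ouKernel t x)
      (ouKernel t x s * ((x - Real.exp (-t) * s) * Real.exp (-t) / (1 - Real.exp (-2 * t)))) s := by
  have h1 : HasDerivAt (fun s => x - Real.exp (-t) * s) (-(Real.exp (-t) * 1)) s :=
    ((hasDerivAt_id s).const_mul _).const_sub x
  have h2 := (((h1.pow 2).neg.div_const (2 * (1 - Real.exp (-2 * t)))).exp).const_mul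
    (Real.sqrt (2 * π * (1 - Real.exp (-2 * t))))⁻¹
  refine h2.congr_deriv ?_
  simp only [ouKernel, Pi.neg_apply, Pi.pow_apply]
  generalize 1 - Real.exp (-2 * t) = v
  ring

theorem deriv_ouKernel_source (t x : ℝ) :
    deriv (ouKernel t x) = fun s =>
      ouKernel t x s * ((x - Real.exp (-t) * s) * Real.exp (-t) / (1 - Real.exp (-2 * t))) :=
  funext fun s => (hasDerivAt_ouKernel_source t x s).deriv

theorem deriv_deriv_ouKernel_source (t x : ℝ) :
    deriv (deriv (ouKernel t x)) = fun s =>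
      ouKernel t x s * (((x - Real.exp (-t) * s) * Real.exp (-t) / (1 - Real.exp (-2 * t))) ^ 2
        - Real.exp (-t) ^ 2 / (1 - Real.exp (-2 * t))) := by
  rw [deriv_ouKernel_source]
  funext s
  have h1 : HasDerivAt (fun s => x - Real.exp (-t) * s) (-(Real.exp (-t) * 1)) s :=
    ((hasDerivAt_id s).const_mul _).const_sub x
  have h2 := (hasDerivAt_ouKernel_source t x s).mul
    ((h1.mul_const (Real.exp (-t))).div_const (1 - Real.exp (-2 * t)))
  refine h2.deriv.trans ?_
  ring

/-- The logarithmic time derivative of the Ornstein–Uhlenbeck kernel. -/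
def ouKernelLogDeriv (t x s : ℝ) : ℝ :=
  ((x - Real.exp (-t) * s) * Real.exp (-t) / (1 - Real.exp (-2 * t))) ^ 2
    - Real.exp (-t) ^ 2 / (1 - Real.exp (-2 * t))
    - s * ((x - Real.exp (-t) * s) * Real.exp (-t) / (1 - Real.exp (-2 * t)))

theorem hasDerivAt_ouKernel_time {t : ℝ} (ht : 0 < t) (x s : ℝ) :
    HasDerivAt (fun t => ouKernel t x s) (ouKernel t x s * ouKernelLogDeriv t x s) t := by
  have hv := one_sub_exp_pos ht
  have ha : HasDerivAt (fun t : ℝ => Real.exp (-t)) (Real.exp (-t) * -1) t :=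
    (hasDerivAt_neg t).exp
  have hv' : HasDerivAt (fun t : ℝ => 1 - Real.exp (-2 * t))
      (-(Real.exp (-2 * t) * (-2 * 1))) t :=
    ((hasDerivAt_id t).const_mul (-2)).exp.const_sub 1
  have hw : HasDerivAt (fun t : ℝ => (Real.sqrt (2 * π * (1 - Real.exp (-2 * t))))⁻¹) _ t :=
    ((hv'.const_mul (2 * π)).sqrt (by positivity)).inv (by positivity)
  have he : HasDerivAt (fun t : ℝ =>
      Real.exp (-(x - Real.exp (-t) * s) ^ 2 / (2 * (1 - Real.exp (-2 * t))))) _ t :=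
    (((((ha.mul_const s).const_sub x).pow 2).neg).div (hv'.const_mul 2) (by positivity)).exp
  refine (hw.mul he).congr_deriv ?_
  have hee : Real.exp (-2 * t) = Real.exp (-t) ^ 2 := by
    rw [← Real.exp_nat_mul]; congr 1; push_cast; ring
  have hq : Real.sqrt (2 * π * (1 - Real.exp (-2 * t))) ^ 2 =
      2 * π * (1 - Real.exp (-2 * t)) := Real.sq_sqrt (by positivity)
  have hq0 : Real.sqrt (2 * π * (1 - Real.exp (-2 * t))) ≠ 0 := by positivity
  simp only [ouKernel, ouKernelLogDeriv, Pi.neg_apply, Pi.pow_apply]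
  rw [hq]
  generalize Real.sqrt (2 * π * (1 - Real.exp (-2 * t))) = w at *
  generalize Real.exp (-(x - Real.exp (-t) * s) ^ 2 / (2 * (1 - Real.exp (-2 * t)))) = E
  rw [hee] at hv ⊢
  have hv0 := hv.ne'
  field_simp
  ring

theorem abs_ouKernelLogDeriv_le {r t : ℝ} (hr : 0 < r) (hrt : r ≤ t) (x s : ℝ) :
    |ouKernelLogDeriv t x s| ≤
      ((|x| + |s|) / (1 - Real.exp (-2 * r))) ^ 2 + 1 / (1 - Real.exp (-2 * r))
        + |s| * ((|x| + |s|) / (1 - Real.exp (-2 * r))) := by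
  have hv0 := one_sub_exp_pos hr
  have hv : 1 - Real.exp (-2 * r) ≤ 1 - Real.exp (-2 * t) := by
    have : Real.exp (-2 * t) ≤ Real.exp (-2 * r) := Real.exp_le_exp.2 (by linarith)
    linarith
  have ha0 : 0 < Real.exp (-t) := Real.exp_pos _
  have ha : Real.exp (-t) ≤ 1 := Real.exp_le_one_iff.2 (by linarith)
  have hu : |x - Real.exp (-t) * s| ≤ |x| + |s| := by
    refine (abs_sub _ _).trans ?_
    rw [abs_mul, abs_of_pos ha0]
    have := mul_le_of_le_one_left (abs_nonneg s) ha
    linarith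
  have hq : |(x - Real.exp (-t) * s) * Real.exp (-t) / (1 - Real.exp (-2 * t))| ≤
      (|x| + |s|) / (1 - Real.exp (-2 * r)) := by
    rw [abs_div, abs_mul, abs_of_pos ha0, abs_of_pos (hv0.trans_le hv)]
    refine div_le_div₀ (by positivity) ?_ hv0 hv
    exact (mul_le_of_le_one_right (abs_nonneg _) ha).trans hu
  have hp : |Real.exp (-t) ^ 2 / (1 - Real.exp (-2 * t))| ≤ 1 / (1 - Real.exp (-2 * r)) := by
    rw [abs_div, abs_of_pos (hv0.trans_le hv), abs_of_pos (by positivity)]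
    exact div_le_div₀ zero_le_one (pow_le_one₀ ha0.le ha) hv0 hv
  unfold ouKernelLogDeriv
  refine (abs_sub _ _).trans (add_le_add ((abs_sub _ _).trans (add_le_add ?_ hp)) ?_)
  · rw [abs_pow]
    exact pow_le_pow_left₀ (abs_nonneg _) hq 2
  · rw [abs_mul]
    exact mul_le_mul_of_nonneg_left hq (abs_nonneg _)

theorem integrable_ouKernel_mul {Ω : Type*} [MeasurableSpace Ω] {μ : Measure Ω}
    {S : Ω → ℝ} (hS : Measurable S) {F : Ω → ℝ} (hF : Integrable F μ) {t : ℝ} (ht : 0 < t)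
    (x : ℝ) : Integrable (fun ω => ouKernel t x (S ω) * F ω) μ := by
  refine hF.bdd_mul ((contDiff_ouKernel t x).continuous.measurable.comp hS).aestronglyMeasurable
    (c := (Real.sqrt (2 * π * (1 - Real.exp (-2 * t))))⁻¹) (Eventually.of_forall fun ω => ?_)
  rw [Real.norm_eq_abs, abs_of_pos (ouKernel_pos ht _ _)]
  exact ouKernel_le ht _ _

theorem integrable_ouKernel {Ω : Type*} [MeasurableSpace Ω] {μ : Measure Ω}
    [IsFiniteMeasure μ] {S : Ω → ℝ} (hS : Measurable S) {t : ℝ} (ht : 0 < t) (x : ℝ) :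
    Integrable (fun ω => ouKernel t x (S ω)) μ := by
  simpa using integrable_ouKernel_mul hS (integrable_const (1 : ℝ)) ht x

theorem hasDerivAt_integral_ouKernel {Ω : Type*} [MeasurableSpace Ω] {μ : Measure Ω}
    [IsFiniteMeasure μ] {S : Ω → ℝ} (hS : Measurable S) (hS2 : MemLp S 2 μ) {t : ℝ}
    (ht : 0 < t) (x : ℝ) :
    HasDerivAt (fun t => ∫ ω, ouKernel t x (S ω) ∂μ)
      (∫ ω, ouKernel t x (S ω) * ouKernelLogDeriv t x (S ω) ∂μ) t := by
  set r := t / 2 with hr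
  have hr0 : 0 < r := by positivity
  have hv0 := one_sub_exp_pos hr0
  have hSi : Integrable (fun ω => |S ω|) μ := (hS2.integrable one_le_two).abs
  have hSq : Integrable (fun ω => |S ω| ^ 2) μ := by
    simpa only [sq_abs] using hS2.integrable_sq
  refine (hasDerivAt_integral_of_dominated_loc_of_deriv_le (s := Set.Ioi r)
    (F := fun t ω => ouKernel t x (S ω))
    (F' := fun t ω => ouKernel t x (S ω) * ouKernelLogDeriv t x (S ω))
    (bound := fun ω => (Real.sqrt (2 * π * (1 - Real.exp (-2 * r))))⁻¹ *
      (((|x| + |S ω|) / (1 - Real.exp (-2 * r))) ^ 2 + 1 / (1 - Real.exp (-2 * r))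
        + |S ω| * ((|x| + |S ω|) / (1 - Real.exp (-2 * r)))))
    (Ioi_mem_nhds (by linarith)) ?_ (integrable_ouKernel hS ht x) ?_ ?_ ?_ ?_).2
  · exact Eventually.of_forall fun t =>
      ((contDiff_ouKernel t x).continuous.measurable.comp hS).aestronglyMeasurable
  · have h2 : Measurable (ouKernelLogDeriv t x) := by unfold ouKernelLogDeriv; fun_prop
    exact (((contDiff_ouKernel t x).continuous.measurable.comp hS).mul
      (h2.comp hS)).aestronglyMeasurable
  · refine Eventually.of_forall fun ω u hu => ?_
    have hu' : r < u := hu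
    have hu0 := hr0.trans hu'
    rw [norm_mul, Real.norm_eq_abs, Real.norm_eq_abs, abs_of_pos (ouKernel_pos hu0 _ _)]
    refine mul_le_mul ((ouKernel_le hu0 _ _).trans ?_) (abs_ouKernelLogDeriv_le hr0 hu'.le _ _)
      (abs_nonneg _) (by positivity)
    have : Real.exp (-2 * u) ≤ Real.exp (-2 * r) := Real.exp_le_exp.2 (by linarith)
    gcongr
  · refine Integrable.const_mul ?_ _
    have h := ((hSq.const_mul (1 / (1 - Real.exp (-2 * r)) ^ 2 + 1 / (1 - Real.exp (-2 * r)))).add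
      (hSi.const_mul (2 * |x| / (1 - Real.exp (-2 * r)) ^ 2 + |x| / (1 - Real.exp (-2 * r))))).add
      (integrable_const (|x| ^ 2 / (1 - Real.exp (-2 * r)) ^ 2 + 1 / (1 - Real.exp (-2 * r))))
    refine h.congr (Eventually.of_forall fun ω => ?_)
    simp only [Pi.add_apply]
    field_simp
    ring
  · exact Eventually.of_forall fun ω u hu => hasDerivAt_ouKernel_time (hr0.trans hu) x (S ω)

/-- The time derivative of the Ornstein–Uhlenbeck density in terms of the score functions. -/
theorem integral_ouKernel_mul_logDeriv {Ω : Type*} [MeasurableSpace Ω] {μ : Measure Ω}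
    [IsFiniteMeasure μ] {S : Ω → ℝ} (hS : Measurable S) (hS2 : MemLp S 2 μ) {ρ I : ℝ → ℝ}
    (hρ : IsScoreFun μ S ρ) (hI : IsScoreFun2 μ S I)
    (hρS : Integrable (fun ω => ρ (S ω) * S ω) μ) {t : ℝ} (ht : 0 < t) (x : ℝ) :
    ∫ ω, ouKernel t x (S ω) * ouKernelLogDeriv t x (S ω) ∂μ =
      ∫ ω, ouKernel t x (S ω) * (I (S ω) + ρ (S ω) * S ω + 1) ∂μ := by
  have hv0 := (one_sub_exp_pos ht).ne'
  have hSi : Integrable S μ := hS2.integrable one_le_two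
  have hSq : Integrable (fun ω => S ω ^ 2) μ := hS2.integrable_sq
  have hpoly : ∀ a b c : ℝ, Integrable
      (fun ω => ouKernel t x (S ω) * (a + b * S ω + c * S ω ^ 2)) μ := fun a b c =>
    integrable_ouKernel_mul hS
      (((integrable_const a).add (hSi.const_mul b)).add (hSq.const_mul c)) ht x
  have hK := integrable_ouKernel (μ := μ) hS ht x
  set a := Real.exp (-t) with ha
  set v := 1 - Real.exp (-2 * t) with hv
  have hK1 : Integrable (fun ω => deriv (ouKernel t x) (S ω)) μ := by
    refine (hpoly (x * a / v) (-a ^ 2 / v) 0).congr (Eventually.of_forall fun ω => ?_)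
    simp only [deriv_ouKernel_source, ← ha, ← hv]
    ring
  have hK2 : Integrable (fun ω => deriv (deriv (ouKernel t x)) (S ω)) μ := by
    refine (hpoly ((x * a / v) ^ 2 - a ^ 2 / v) (-2 * x * a ^ 3 / v ^ 2) (a ^ 4 / v ^ 2)).congr
      (Eventually.of_forall fun ω => ?_)
    rw [deriv_deriv_ouKernel_source, ← ha, ← hv]
    clear_value v
    ring
  have hsK1 : Integrable (fun ω => S ω * deriv (ouKernel t x) (S ω)) μ := by
    refine (hpoly 0 (x * a / v) (-a ^ 2 / v)).congr (Eventually.of_forall fun ω => ?_)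
    simp only [deriv_ouKernel_source, ← ha, ← hv]
    ring
  have hsK : Integrable (fun ω => S ω * ouKernel t x (S ω)) μ := by
    refine (hpoly 0 1 0).congr (Eventually.of_forall fun ω => ?_)
    ring
  have hIK := integrable_ouKernel_mul hS hI.1 ht x
  have hρK := integrable_ouKernel_mul hS hρS ht x
  have hd : deriv (fun s => s * ouKernel t x s) =
      fun s => ouKernel t x s + s * deriv (ouKernel t x) s := by
    funext s
    have h := (hasDerivAt_id s).mul (hasDerivAt_ouKernel_source t x s).differentiableAt.hasDerivAt
    refine h.deriv.trans ?_
    simp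
  have e2 := hI.integral_mul_eq hS (contDiff_ouKernel t x)
    (hIK.congr (Eventually.of_forall fun ω => mul_comm _ _)) hK hK1 hK2
  have e1 := hρ.integral_mul_eq hS (Ψ := fun s => s * ouKernel t x s)
    (contDiff_id.mul (contDiff_ouKernel t x))
    (hρK.congr (Eventually.of_forall fun ω => by ring)) hsK
    (by rw [hd]; exact hK.add hsK1)
  rw [hd, integral_add hK hsK1] at e1
  have eL : ∫ ω, ouKernel t x (S ω) * ouKernelLogDeriv t x (S ω) ∂μ =
      ∫ ω, deriv (deriv (ouKernel t x)) (S ω) ∂μ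
        - ∫ ω, S ω * deriv (ouKernel t x) (S ω) ∂μ := by
    rw [← integral_sub hK2 hsK1]
    refine integral_congr_ae (Eventually.of_forall fun ω => ?_)
    beta_reduce
    rw [deriv_deriv_ouKernel_source, deriv_ouKernel_source, ouKernelLogDeriv]
    ring
  have eR : ∫ ω, ouKernel t x (S ω) * (I (S ω) + ρ (S ω) * S ω + 1) ∂μ =
      (∫ ω, I (S ω) * ouKernel t x (S ω) ∂μ
        + ∫ ω, ρ (S ω) * (S ω * ouKernel t x (S ω)) ∂μ) + ∫ ω, ouKernel t x (S ω) ∂μ := by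
    have i1 : Integrable (fun ω => I (S ω) * ouKernel t x (S ω)) μ :=
      hIK.congr (Eventually.of_forall fun ω => mul_comm _ _)
    have i2 : Integrable (fun ω => ρ (S ω) * (S ω * ouKernel t x (S ω))) μ :=
      hρK.congr (Eventually.of_forall fun ω => by ring)
    have i12 : Integrable
        (fun ω => I (S ω) * ouKernel t x (S ω) + ρ (S ω) * (S ω * ouKernel t x (S ω))) μ :=
      i1.add i2
    rw [← integral_add i1 i2, ← integral_add i12 hK]
    exact integral_congr_ae (Eventually.of_forall fun ω => by ring)
  rw [eL, eR, e2, e1]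
  ring

/-- A continuous Lebesgue density with convex support is nonnegative. -/
theorem HasLebDensity.nonneg {Ω : Type*} [MeasurableSpace Ω] {μ : Measure Ω}
    [IsProbabilityMeasure μ] {S : Ω → ℝ} (hS : Measurable S) {f : ℝ → ℝ}
    (hf : HasLebDensity μ S f) (hc : Continuous f) (hconv : Convex ℝ (Function.support f))
    (x : ℝ) : 0 ≤ f x := by
  by_contra! hx
  have hex : ∃ y, 0 < f y := by
    by_contra! hneg
    have h1 : Measure.map S μ Set.univ = 1 := by
      rw [Measure.map_apply hS MeasurableSet.univ]; simp
    have h0 : (fun x => ENNReal.ofReal (f x)) = 0 :=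
      funext fun y => ENNReal.ofReal_of_nonpos (hneg y)
    rw [hf, h0] at h1
    simp at h1
  obtain ⟨y, hy⟩ := hex
  obtain ⟨z, hz, hz0⟩ := hconv.isPreconnected.intermediate_value (a := x) (b := y)
    hx.ne hy.ne' hc.continuousOn ⟨hx.le, hy.le⟩
  exact hz hz0

theorem ouDensity_eq_integral_ouKernel {Ω : Type*} [MeasurableSpace Ω] {μ : Measure Ω}
    {S : Ω → ℝ} (hS : Measurable S) {f : ℝ → ℝ} (hf : HasLebDensity μ S f)
    (hfm : Measurable f) (hf0 : ∀ x, 0 ≤ f x) {t : ℝ} (ht : 0 < t) (x : ℝ) :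
    ouDensity f t x = ∫ ω, ouKernel t x (S ω) ∂μ := by
  have hv := one_sub_exp_pos ht
  have ha : 0 < Real.exp (-t) := Real.exp_pos _
  have e1 : ∫ ω, ouKernel t x (S ω) ∂μ = ∫ s, f s * ouKernel t x s := by
    rw [← integral_map hS.aemeasurable
      (contDiff_ouKernel t x).continuous.aestronglyMeasurable, hf,
      integral_withDensity_eq_integral_toReal_smul (by fun_prop) (by simp)]
    refine integral_congr_ae (Eventually.of_forall fun s => ?_)
    simp [ENNReal.toReal_ofReal (hf0 s)]
  rw [ouDensity, if_neg ht.ne', e1]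
  set G : ℝ → ℝ := fun y =>
    stdGaussianDensity (y / Real.sqrt (1 - Real.exp (-2 * t))) / Real.sqrt (1 - Real.exp (-2 * t))
      * (f ((x - y) / Real.exp (-t)) / Real.exp (-t)) with hG
  have e2 : ∫ y, G y = ∫ y, G (x - y) := (integral_sub_left_eq_self G volume x).symm
  have e3 := Measure.integral_comp_mul_left (fun y => G (x - y)) (Real.exp (-t))
  rw [abs_of_pos (inv_pos.2 ha), smul_eq_mul] at e3
  have e4 : ∫ y, G y = Real.exp (-t) * ∫ s, G (x - Real.exp (-t) * s) := by
    rw [e3, e2]; field_simp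
  change ∫ y, G y = _
  rw [e4, ← integral_const_mul]
  refine integral_congr_ae (Eventually.of_forall fun s => ?_)
  have hs : (x - (x - Real.exp (-t) * s)) / Real.exp (-t) = s := by field_simp; ring
  simp only [hG, stdGaussianDensity, ouKernel, hs]
  rw [div_pow, Real.sq_sqrt hv.le, Real.sqrt_mul (by positivity) (1 - Real.exp (-2 * t))]
  have hexp : -((x - Real.exp (-t) * s) ^ 2 / (1 - Real.exp (-2 * t))) / 2 =
      -(x - Real.exp (-t) * s) ^ 2 / (2 * (1 - Real.exp (-2 * t))) := by
    field_simp
  rw [hexp]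
  field_simp

theorem lintegral_ouKernel {t : ℝ} (ht : 0 < t) (s : ℝ) :
    ∫⁻ x, ENNReal.ofReal (ouKernel t x s) = 1 := by
  have hv := one_sub_exp_pos ht
  have h := lintegral_gaussianPDFReal_eq_one (Real.exp (-t) * s)
    (v := (1 - Real.exp (-2 * t)).toNNReal) (by simpa using hv)
  simpa only [gaussianPDFReal, ouKernel, Real.coe_toNNReal _ hv.le] using h

/-- Cauchy–Schwarz inequality with a positive weight. -/
theorem sq_integral_mul_le {Ω : Type*} [MeasurableSpace Ω] {μ : Measure Ω} {k L : Ω → ℝ}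
    (hk0 : ∀ ω, 0 ≤ k ω) (hk : Integrable k μ) (hL : Integrable (fun ω => k ω * L ω) μ)
    (hL2 : Integrable (fun ω => k ω * L ω ^ 2) μ) (hpos : 0 < ∫ ω, k ω ∂μ) :
    (∫ ω, k ω * L ω ∂μ) ^ 2 / ∫ ω, k ω ∂μ ≤ ∫ ω, k ω * L ω ^ 2 ∂μ := by
  set A := ∫ ω, k ω ∂μ
  set B := ∫ ω, k ω * L ω ∂μ
  have h : 0 ≤ ∫ ω, (k ω * L ω ^ 2 - 2 * (B / A) * (k ω * L ω)) + (B / A) ^ 2 * k ω ∂μ := by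
    refine integral_nonneg fun ω => ?_
    have : (k ω * L ω ^ 2 - 2 * (B / A) * (k ω * L ω)) + (B / A) ^ 2 * k ω =
        k ω * (L ω - B / A) ^ 2 := by ring
    simp only [Pi.zero_apply, this]
    exact mul_nonneg (hk0 ω) (sq_nonneg _)
  have hsub : Integrable (fun ω => k ω * L ω ^ 2 - 2 * (B / A) * (k ω * L ω)) μ :=
    hL2.sub (hL.const_mul _)
  rw [integral_add hsub (hk.const_mul _), integral_sub hL2 (hL.const_mul _), integral_const_mul, integral_const_mul] at h
  have e : 2 * (B / A) * B - (B / A) ^ 2 * A = B ^ 2 / A := by field_simp; ring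
  change 0 ≤ _ - 2 * (B / A) * B + (B / A) ^ 2 * A at h
  linarith

theorem sqrt_mul_abs_div_le {f d p : ℝ} (hf : 0 ≤ f) (hp : 0 < p) :
    Real.sqrt f * |d / (2 * Real.sqrt p)| ≤ f + d ^ 2 / p := by
  have hs : 0 < Real.sqrt p := Real.sqrt_pos.2 hp
  have e : d ^ 2 / p = (|d| / Real.sqrt p) ^ 2 := by
    rw [div_pow, Real.sq_sqrt hp.le, sq_abs]
  rw [e, abs_div, abs_of_pos (by positivity : 0 < 2 * Real.sqrt p)]
  have e' : |d| / (2 * Real.sqrt p) = (|d| / Real.sqrt p) / 2 := by field_simp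
  rw [e']
  nlinarith [sq_nonneg (Real.sqrt f - |d| / Real.sqrt p), Real.sq_sqrt hf,
    sq_nonneg (Real.sqrt f), sq_nonneg (|d| / Real.sqrt p)]

theorem lintegral_ofReal_integral_ouKernel_mul {Ω : Type*} [MeasurableSpace Ω]
    {μ : Measure Ω} [SFinite μ] {S : Ω → ℝ} (hS : Measurable S) {F : Ω → ℝ}
    (hF0 : ∀ ω, 0 ≤ F ω) (hF : Integrable F μ) {t : ℝ} (ht : 0 < t) :
    ∫⁻ x, ENNReal.ofReal (∫ ω, ouKernel t x (S ω) * F ω ∂μ) =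
      ∫⁻ ω, ENNReal.ofReal (F ω) ∂μ := by
  have e : ∀ x, ENNReal.ofReal (∫ ω, ouKernel t x (S ω) * F ω ∂μ) =
      ∫⁻ ω, ENNReal.ofReal (ouKernel t x (S ω)) * ENNReal.ofReal (F ω) ∂μ := fun x => by
    rw [ofReal_integral_eq_lintegral_ofReal (integrable_ouKernel_mul hS hF ht x)
      (Eventually.of_forall fun ω => mul_nonneg (ouKernel_pos ht _ _).le (hF0 ω))]
    exact lintegral_congr fun ω => ENNReal.ofReal_mul (ouKernel_pos ht _ _).le
  have hKm : Measurable (fun p : ℝ × Ω => ouKernel t p.1 (S p.2)) := by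
    unfold ouKernel
    fun_prop
  simp_rw [e]
  rw [lintegral_lintegral_swap]
  · refine lintegral_congr fun ω => ?_
    rw [lintegral_mul_const' _ _ ENNReal.ofReal_ne_top, lintegral_ouKernel ht, one_mul]
  · have hF' : AEMeasurable (fun p : ℝ × Ω => F p.2) (volume.prod μ) :=
      hF.aestronglyMeasurable.comp_snd.aemeasurable
    have hK' : AEMeasurable (fun p : ℝ × Ω => ENNReal.ofReal (ouKernel t p.1 (S p.2)))
        (volume.prod μ) := hKm.ennreal_ofReal.aemeasurable
    exact hK'.mul hF'.ennreal_ofReal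

/-- Fubini precondition,
`∫₀^T ∫_{Ω_S} √(f_S(x)) |∂_t √(f_{Z_t}(x))| dx dt < ∞`. -/
theorem fubini_precondition
    {Ω : Type*} [MeasurableSpace Ω] (μ : Measure Ω) [IsProbabilityMeasure μ]
    (S : Ω → ℝ) (hSmeas : Measurable S)
    (fS : ℝ → ℝ) (hdens : HasLebDensity μ S fS)
    (hC1 : ContDiff ℝ 1 fS) (hconv : Convex ℝ (Function.support fS))
    (hmean : ∫ ω, S ω ∂μ = 0) (hvar : ∫ ω, (S ω) ^ 2 ∂μ = 1)
    (ρS IS : ℝ → ℝ)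
    (hscore : IsScoreFun μ S ρS) (hscore2 : IsScoreFun2 μ S IS)
    (hρL2 : Integrable (fun ω => (ρS (S ω)) ^ 2) μ)
    (hIL2 : Integrable (fun ω => (IS (S ω)) ^ 2) μ)
    (hρSL2 : Integrable (fun ω => (ρS (S ω) * S ω) ^ 2) μ) :
    ∀ T > (0 : ℝ),
      (∫⁻ t in Set.Ioc (0 : ℝ) T, ∫⁻ x in Function.support fS,
          ENNReal.ofReal (Real.sqrt (fS x) *
            |deriv (fun t' => Real.sqrt (ouDensity fS t' x)) t|)) < ⊤ := by
  have hS2 : MemLp S 2 μ := by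
    refine (memLp_two_iff_integrable_sq hSmeas.aestronglyMeasurable).2 ?_
    by_contra h
    rw [integral_undef h] at hvar
    exact zero_ne_one hvar
  have hf0 := hdens.nonneg hSmeas hC1.continuous hconv
  have hfi : ∫⁻ x, ENNReal.ofReal (fS x) = 1 := by
    rw [← setLIntegral_univ, ← withDensity_apply _ MeasurableSet.univ, ← hdens,
      Measure.map_apply hSmeas MeasurableSet.univ]
    simp
  have hρS : MemLp (fun ω => ρS (S ω) * S ω) 2 μ :=
    (memLp_two_iff_integrable_sq
      (hscore.1.aestronglyMeasurable.mul hSmeas.aestronglyMeasurable)).2 hρSL2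
  have hI : MemLp (fun ω => IS (S ω)) 2 μ :=
    (memLp_two_iff_integrable_sq hscore2.1.aestronglyMeasurable).2 hIL2
  have hL : MemLp (fun ω => IS (S ω) + ρS (S ω) * S ω + 1) 2 μ :=
    (hI.add hρS).add (memLp_const 1)
  have hpt : ∀ t > 0, ∀ x, Real.sqrt (fS x) *
      |deriv (fun t' => Real.sqrt (ouDensity fS t' x)) t| ≤
        fS x + ∫ ω, ouKernel t x (S ω) * (IS (S ω) + ρS (S ω) * S ω + 1) ^ 2 ∂μ := by
    intro t ht x
    have hK := integrable_ouKernel (μ := μ) hSmeas ht x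
    have hpos : 0 < ∫ ω, ouKernel t x (S ω) ∂μ := by
      rw [integral_pos_iff_support_of_nonneg (fun ω => (ouKernel_pos ht _ _).le) hK]
      have : Function.support (fun ω => ouKernel t x (S ω)) = Set.univ :=
        Set.eq_univ_of_forall fun ω => (ouKernel_pos ht _ _).ne'
      simp [this]
    have hd := hasDerivAt_integral_ouKernel hSmeas hS2 ht x
    rw [integral_ouKernel_mul_logDeriv hSmeas hS2 hscore hscore2
      (hρS.integrable one_le_two) ht x] at hd
    have heq : (fun t' => Real.sqrt (ouDensity fS t' x)) =ᶠ[nhds t]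
        fun t' => Real.sqrt (∫ ω, ouKernel t' x (S ω) ∂μ) := by
      filter_upwards [Ioi_mem_nhds ht] with u hu
      rw [ouDensity_eq_integral_ouKernel hSmeas hdens hC1.continuous.measurable hf0 hu x]
    rw [heq.deriv_eq, (hd.sqrt hpos.ne').deriv]
    refine (sqrt_mul_abs_div_le (hf0 x) hpos).trans (add_le_add_right ?_ _)
    exact sq_integral_mul_le (fun ω => (ouKernel_pos ht _ _).le) hK
      (integrable_ouKernel_mul hSmeas (hL.integrable one_le_two) ht x)
      (integrable_ouKernel_mul hSmeas hL.integrable_sq ht x) hpos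
  set M := 1 + ∫⁻ ω, ENNReal.ofReal ((IS (S ω) + ρS (S ω) * S ω + 1) ^ 2) ∂μ with hM
  have hMtop : M < ⊤ := ENNReal.add_lt_top.2 ⟨ENNReal.one_lt_top, hL.integrable_sq.lintegral_lt_top⟩
  have hinner : ∀ t > 0, ∫⁻ x in Function.support fS, ENNReal.ofReal (Real.sqrt (fS x) *
      |deriv (fun t' => Real.sqrt (ouDensity fS t' x)) t|) ≤ M := by
    intro t ht
    refine (setLIntegral_le_lintegral _ _).trans ?_
    refine (lintegral_mono fun x =>
      (ENNReal.ofReal_le_ofReal (hpt t ht x)).trans ENNReal.ofReal_add_le).trans ?_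
    rw [lintegral_add_left hC1.continuous.measurable.ennreal_ofReal, hfi,
      lintegral_ofReal_integral_ouKernel_mul hSmeas (fun ω => sq_nonneg _)
        hL.integrable_sq ht]
  intro T _
  calc _ ≤ ∫⁻ _ in Set.Ioc (0 : ℝ) T, M := setLIntegral_mono measurable_const
        fun t ht => hinner t ht.1
    _ < ⊤ := by
      rw [setLIntegral_const]
      exact ENNReal.mul_lt_top hMtop (by simp)

end
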